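/- Let a be an integer with a ≥ 3. Then there exists θ ∈ [0,1] such that the real number α = [0; s_{θ,0}], whose partial quotients are the letters of the mechanical word s_{θ,0} over {1, a} with slope θ and intercept 0, has Lévy constant L(α) = π²/(12 log 2). -/

import Mathlib

open Filter Real Matrix

noncomputable section

/-- `contQ w n` is the denominator `Q n` of the `n`-th convergent of the
continued fraction `[0; w 1, w 2, …]`. -/
def contQ (w : ℕ → ℕ) : ℕ → ℕ
  | 0 => 1
  | 1 => w 1
  | n + 2 => w (n + 2) * contQ w (n + 1) + contQ w n

/-- The real number `[0; w 1, w 2, …]` has Lévy constant `ℓ`, i.e. the sequence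
`(log Q n)/n` converges to `ℓ`. -/
def HasLevyConstant (w : ℕ → ℕ) (ℓ : ℝ) : Prop :=
  Tendsto (fun n : ℕ => Real.log (contQ w n) / n) atTop (nhds ℓ)

/-- `L` is a (finite) factor of the infinite word `w = w 1 w 2 ⋯`. -/
def IsFactorSeq (w : ℕ → ℕ) (L : List ℕ) : Prop :=
  ∃ i : ℕ, L = (List.range L.length).map fun j => w (i + j + 1)

/-- The complexity function `p(n, w)`: the number of distinct factors of length `n`. -/
def complexity (w : ℕ → ℕ) (n : ℕ) : ℕ :=
  Set.ncard {L : List ℕ | L.length = n ∧ IsFactorSeq w L}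

/-- The mechanical word `s_{θ,ρ}` over `{a,b}` (floor version), indexed from `1`. -/
def mechWord (a b : ℕ) (θ ρ : ℝ) (n : ℕ) : ℕ :=
  if ⌊(n : ℝ) * θ + ρ⌋ - ⌊((n : ℝ) - 1) * θ + ρ⌋ = 0 then a else b

/-- The mechanical word `s'_{θ,ρ}` over `{a,b}` (ceiling version), indexed from `1`. -/
def mechWord' (a b : ℕ) (θ ρ : ℝ) (n : ℕ) : ℕ :=
  if ⌈(n : ℝ) * θ + ρ⌉ - ⌈((n : ℝ) - 1) * θ + ρ⌉ = 0 then a else b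

/-- `w` is a Sturmian word over `{a, b}`: a mechanical word with irrational slope. -/
def IsSturmianWord (a b : ℕ) (w : ℕ → ℕ) : Prop :=
  ∃ θ ρ : ℝ, Irrational θ ∧ θ ∈ Set.Icc (0 : ℝ) 1 ∧ ρ ∈ Set.Ico (0 : ℝ) 1 ∧
    (w = mechWord a b θ ρ ∨ w = mechWord' a b θ ρ)

/-- The matrix `[[x, 1], [1, 0]]`. -/
def cfMat (x : ℝ) : Matrix (Fin 2) (Fin 2) ℝ := !![x, 1; 1, 0]

/-- `T(b₁, …, b_n)`: the trace of `[[b₁,1],[1,0]] ⋯ [[b_n,1],[1,0]]` for a word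
`b₁ ⋯ b_n` over the positive integers.  The trace of the empty word is `2`. -/
def traceWord (L : List ℕ) : ℝ := ((L.map fun c => cfMat (c : ℝ)).prod).trace

/-- The polynomial `𝐓_n(x) = Tr([[x,1],[1,0]]^n)`. -/
def Tpoly (n : ℕ) (x : ℝ) : ℝ := ((cfMat x) ^ n).trace

/-- The lower Christoffel word `w_{p/q}` over `{a, b}`: the prefix of length `q`
of the mechanical word `s_{p/q, 0}`. -/
def christoffel (a b p q : ℕ) : List ℕ :=
  (List.range q).map fun n => mechWord a b ((p : ℝ) / (q : ℝ)) 0 (n + 1)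

/-- `T(w_{p/q})`, the trace attached to the lower Christoffel word of slope `p/q`. -/
def Tw (a b p q : ℕ) : ℝ := traceWord (christoffel a b p q)

/-- The continuant `K(b₁, …, b_n)`: the denominator of `[0; b₁, …, b_n]`. -/
def contList : List ℕ → ℕ
  | [] => 1
  | [x] => x
  | x :: y :: t => x * contList (y :: t) + contList t

/-- The standard words attached to `d₁, d₂, …` : `sturmM a b d (k+1)` is the word
`M_k`, where `M_{-1} = b`, `M_0 = a` and `M_k = M_{k-1}^{d_k} M_{k-2}`. -/
def sturmM (a b : ℕ) (d : ℕ → ℕ) : ℕ → List ℕ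
  | 0 => [b]
  | 1 => [a]
  | k + 2 => (List.replicate (d (k + 1)) (sturmM a b d (k + 1))).flatten ++ sturmM a b d k

/-- Denominators `q_k` of the convergents of `θ = [0; 1 + d₁, d₂, d₃, …]`. -/
def cfQ (d : ℕ → ℕ) : ℕ → ℕ
  | 0 => 1
  | 1 => 1 + d 1
  | k + 2 => d (k + 2) * cfQ d (k + 1) + cfQ d k

/-- Numerators `p_k` of the convergents of `θ = [0; 1 + d₁, d₂, d₃, …]`. -/
def cfP (d : ℕ → ℕ) : ℕ → ℕ
  | 0 => 0
  | 1 => 1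
  | k + 2 => d (k + 2) * cfP d (k + 1) + cfP d k

/-- `w` is ultimately periodic (so that `[0; w 1, w 2, …]` is a quadratic irrational). -/
def UltimatelyPeriodic (w : ℕ → ℕ) : Prop :=
  ∃ r s : ℕ, 0 < s ∧ ∀ n, r < n → w (n + s) = w n

end

/-- The continuant recurrence started one step earlier than `contQ`, at the value `0`. -/
def contQShift (w : ℕ → ℕ) : ℕ → ℕ
  | 0 => 0
  | 1 => 1
  | n + 2 => w (n + 1) * contQShift w (n + 1) + contQShift w n

theorem contQ_eq_contQShift (w : ℕ → ℕ) (n : ℕ) : contQ w n = contQShift w (n + 1) := by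
  induction n using Nat.twoStepInduction with
  | zero => simp [contQ, contQShift]
  | one => simp [contQ, contQShift]
  | more n h1 h2 => rw [contQ, contQShift, h1, h2]

theorem contQShift_congr {w z : ℕ → ℕ} {n : ℕ} (h : ∀ i, 1 ≤ i → i < n → w i = z i) :
    contQShift w n = contQShift z n := by
  induction n using Nat.twoStepInduction with
  | zero => rfl
  | one => rfl
  | more n h1 h2 =>
    rw [contQShift, contQShift, h1 fun i hi hin => h i hi (by omega),
      h2 fun i hi hin => h i hi (by omega), h (n + 1) (by omega) (by omega)]

theorem contQ_congr {w z : ℕ → ℕ} {n : ℕ} (h : ∀ i, 1 ≤ i → i ≤ n → w i = z i) :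
    contQ w n = contQ z n := by
  rw [contQ_eq_contQShift, contQ_eq_contQShift]
  exact contQShift_congr fun i hi hin => h i hi (by omega)

theorem contQShift_le_succ {w : ℕ → ℕ} (hw : ∀ i, 1 ≤ w i) (n : ℕ) :
    contQShift w n ≤ contQShift w (n + 1) := by
  cases n with
  | zero => simp [contQShift]
  | succ n =>
    rw [contQShift]
    nlinarith [hw (n + 1), Nat.zero_le (contQShift w (n + 1)), Nat.zero_le (contQShift w n)]

theorem contQShift_succ_pos {w : ℕ → ℕ} (hw : ∀ i, 1 ≤ w i) (n : ℕ) :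
    1 ≤ contQShift w (n + 1) := by
  induction n with
  | zero => simp [contQShift]
  | succ n ih => exact ih.trans (contQShift_le_succ hw _)

theorem two_mul_contQShift_le {w : ℕ → ℕ} (hw : ∀ i, 1 ≤ w i) (n : ℕ) :
    2 * contQShift w (n + 1) ≤ contQShift w (n + 3) := by
  have h1 := contQShift_le_succ hw (n + 1)
  have h2 : contQShift w (n + 3) = w (n + 2) * contQShift w (n + 2) + contQShift w (n + 1) := rfl
  nlinarith [hw (n + 2)]

theorem contQ_pos {w : ℕ → ℕ} (hw : ∀ i, 1 ≤ w i) (n : ℕ) : 1 ≤ contQ w n := by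
  rw [contQ_eq_contQShift]
  exact contQShift_succ_pos hw n

/-- Splitting a continuant in two; `z` spells the second part of the word backwards. -/
theorem contQShift_add {w z : ℕ → ℕ} {k m : ℕ}
    (h : ∀ i, 1 ≤ i → i ≤ m → z i = w (k + m + 1 - i)) :
    contQShift w (k + m + 1) =
      contQShift w (k + 1) * contQShift z (m + 1) + contQShift w k * contQShift z m := by
  induction m generalizing k with
  | zero => simp [contQShift]
  | succ m ih =>
    have key := @ih (k + 1) fun i hi him => by
      rw [h i hi (by omega)]; congr 1; omega
    have hz : z (m + 1) = w (k + 1) := by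
      rw [h (m + 1) (by omega) le_rfl]; congr 1; omega
    rw [show k + (m + 1) + 1 = k + 1 + m + 1 by ring, key, contQShift, contQShift, hz]
    ring

theorem contQShift_reverse {w z : ℕ → ℕ} {m : ℕ}
    (h : ∀ i, 1 ≤ i → i ≤ m → z i = w (m + 1 - i)) :
    contQShift z (m + 1) = contQShift w (m + 1) := by
  have := contQShift_add (w := w) (z := z) (k := 0) (m := m) fun i hi him => by
    rw [h i hi him]; congr 1; omega
  simpa [contQShift] using this.symm

theorem contQ_add_bounds {w : ℕ → ℕ} (hw : ∀ i, 1 ≤ w i) (k m : ℕ) :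
    contQ w k * contQ (fun i => w (k + i)) m ≤ contQ w (k + m) ∧
      contQ w (k + m) ≤ 2 * (contQ w k * contQ (fun i => w (k + i)) m) := by
  set z : ℕ → ℕ := fun i => w (k + m + 1 - i)
  have hz : ∀ i, 1 ≤ z i := fun i => hw _
  have hrev : contQShift z (m + 1) = contQShift (fun i => w (k + i)) (m + 1) :=
    contQShift_reverse fun i hi him => by
      change w _ = w _
      congr 1; omega
  simp only [contQ_eq_contQShift]
  rw [contQShift_add (z := z) (k := k) (m := m) fun i _ _ => rfl, ← hrev]
  have := Nat.mul_le_mul (contQShift_le_succ hw k) (contQShift_le_succ hz m)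
  constructor <;> nlinarith

theorem abs_log_contQ_add_le {w : ℕ → ℕ} (hw : ∀ i, 1 ≤ w i) (k m : ℕ) :
    |Real.log (contQ w (k + m)) - Real.log (contQ w k) -
      Real.log (contQ (fun i => w (k + i)) m)| ≤ 1 := by
  obtain ⟨h1, h2⟩ := contQ_add_bounds hw k m
  have hk : (0 : ℝ) < contQ w k := by exact_mod_cast contQ_pos hw k
  have hm : (0 : ℝ) < contQ (fun i => w (k + i)) m := by
    exact_mod_cast contQ_pos (fun i => hw (k + i)) m
  have h1' : (contQ w k : ℝ) * contQ (fun i => w (k + i)) m ≤ contQ w (k + m) := by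
    exact_mod_cast h1
  have h2' : (contQ w (k + m) : ℝ) ≤ 2 * (contQ w k * contQ (fun i => w (k + i)) m) := by
    exact_mod_cast h2
  have l1 := Real.log_le_log (by positivity) h1'
  have l2 := Real.log_le_log (lt_of_lt_of_le (by positivity) h1') h2'
  rw [Real.log_mul hk.ne' hm.ne'] at l1
  rw [Real.log_mul two_ne_zero (by positivity), Real.log_mul hk.ne' hm.ne'] at l2
  have := Real.log_two_lt_d9
  rw [abs_le]
  constructor <;> linarith

theorem abs_contQShift_cross_le {u v : ℕ → ℕ} (hu : ∀ i, 1 ≤ u i) (hv : ∀ i, 1 ≤ v i) (j m : ℕ)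
    (h : ∀ i, i < j → i < m → u (j - i) = v (m - i)) :
    |(contQShift u j * contQShift v (m + 1) : ℝ) - contQShift u (j + 1) * contQShift v m| *
      2 ^ min j m ≤ 2 * (contQShift u (j + 1) * contQShift v (m + 1)) := by
  have bound_zero : ∀ j m, min j m = 0 →
      |(contQShift u j * contQShift v (m + 1) : ℝ) - contQShift u (j + 1) * contQShift v m| ≤
        contQShift u (j + 1) * contQShift v (m + 1) := by
    intro j m hjm
    have h1 : (contQShift u j : ℝ) ≤ contQShift u (j + 1) := by
      exact_mod_cast contQShift_le_succ hu j
    have h2 : (contQShift v m : ℝ) ≤ contQShift v (m + 1) := by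
      exact_mod_cast contQShift_le_succ hv m
    have h3 : (0 : ℝ) ≤ contQShift u j := Nat.cast_nonneg _
    have h4 : (0 : ℝ) ≤ contQShift v m := Nat.cast_nonneg _
    rw [abs_le]
    constructor <;> nlinarith
  have step : ∀ j m, u (j + 1) = v (m + 1) →
      |(contQShift u (j + 1) * contQShift v (m + 1 + 1) : ℝ) -
        contQShift u (j + 1 + 1) * contQShift v (m + 1)| =
      |(contQShift u j * contQShift v (m + 1) : ℝ) - contQShift u (j + 1) * contQShift v m| := by
    intro j m hjm
    rw [contQShift, contQShift, hjm, ← abs_neg]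
    congr 1
    push_cast
    ring
  induction hl : min j m using Nat.twoStepInduction generalizing j m with
  | zero =>
    have := bound_zero j m hl
    have h3 : (0 : ℝ) ≤ contQShift u (j + 1) * contQShift v (m + 1) := by positivity
    simp only [pow_zero, mul_one]
    linarith
  | one =>
    obtain ⟨j, rfl⟩ := Nat.exists_eq_succ_of_ne_zero (n := j) (by omega)
    obtain ⟨m, rfl⟩ := Nat.exists_eq_succ_of_ne_zero (n := m) (by omega)
    simp only [Nat.succ_eq_add_one] at *
    rw [step j m (by simpa using h 0 (by omega) (by omega))]
    have h0 := bound_zero j m (by omega)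
    have h1 : (contQShift u (j + 1) : ℝ) ≤ contQShift u (j + 1 + 1) := by
      exact_mod_cast contQShift_le_succ hu _
    have h2 : (contQShift v (m + 1) : ℝ) ≤ contQShift v (m + 1 + 1) := by
      exact_mod_cast contQShift_le_succ hv _
    have := mul_le_mul h1 h2 (by positivity) (by positivity)
    rw [pow_one]
    linarith
  | more l ih _ =>
    obtain ⟨j, rfl⟩ := Nat.exists_eq_add_of_le' (show 2 ≤ j by omega)
    obtain ⟨m, rfl⟩ := Nat.exists_eq_add_of_le' (show 2 ≤ m by omega)
    have e1 := step (j + 1) (m + 1) (by simpa using h 0 (by omega) (by omega))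
    have e2 := step j m (by simpa using h 1 (by omega) (by omega))
    have h0 := ih j m (fun i hi him => by
      simpa [show j + 2 - (i + 2) = j - i by omega, show m + 2 - (i + 2) = m - i by omega]
        using h (i + 2) (by omega) (by omega)) (by omega)
    rw [show j + 2 = j + 1 + 1 by ring, show m + 2 = m + 1 + 1 by ring, e1, e2, pow_add]
    have h1 : (2 * contQShift u (j + 1) : ℝ) ≤ contQShift u (j + 1 + 1 + 1) := by
      exact_mod_cast two_mul_contQShift_le hu j
    have h2 : (2 * contQShift v (m + 1) : ℝ) ≤ contQShift v (m + 1 + 1 + 1) := by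
      exact_mod_cast two_mul_contQShift_le hv m
    have := mul_le_mul h1 h2 (by positivity) (by positivity)
    linarith

theorem abs_log_sub_log_le {x y c : ℝ} {ε : ℝ} (hc : 0 < c) (hx : c ≤ x) (hy : c ≤ y)
    (h : |x - y| ≤ ε * c) : |Real.log x - Real.log y| ≤ ε := by
  have main : ∀ x y : ℝ, c ≤ x → c ≤ y → |x - y| ≤ ε * c → Real.log x - Real.log y ≤ ε := by
    intro x y hx hy h
    have hx0 := hc.trans_le hx
    have hy0 := hc.trans_le hy
    have hε : 0 ≤ ε := by
      by_contra hneg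
      nlinarith [abs_nonneg (x - y)]
    rw [← Real.log_div hx0.ne' hy0.ne']
    have h1 := Real.log_le_sub_one_of_pos (div_pos hx0 hy0)
    have h2 : x / y ≤ ε + 1 := by
      rw [div_le_iff₀ hy0]
      nlinarith [le_abs_self (x - y)]
    linarith
  rw [abs_le]
  constructor
  · linarith [main y x hy hx (by rwa [abs_sub_comm])]
  · exact main x y hx hy h

/-- Swapping two adjacent letters at the centre of a locally palindromic word changes the
logarithm of the continuant by an amount exponentially small in the palindromic radius. -/
theorem abs_log_contQ_swap_le {w z : ℕ → ℕ} {a : ℕ} (hw : ∀ i, 1 ≤ w i)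
    (hwa : ∀ i, w i ≤ a) {k n : ℕ} (hk : 1 ≤ k) (hkn : k < n)
    (hout : ∀ i, 1 ≤ i → i ≤ n → i ≠ k → i ≠ k + 1 → z i = w i)
    (hswap : z k = w (k + 1)) (hswap' : z (k + 1) = w k)
    (hpal : ∀ i, 1 ≤ i → i < k → k + 1 + i ≤ n → w (k - i) = w (k + 1 + i)) :
    |Real.log (contQ w n) - Real.log (contQ z n)| ≤ 2 * a * (1 / 2) ^ min (k - 1) (n - k - 1) := by
  obtain ⟨j, rfl⟩ := Nat.exists_eq_add_of_le' hk
  obtain ⟨m, rfl⟩ := Nat.exists_eq_add_of_le' (show j + 2 ≤ n by omega)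
  rw [show j + 1 - 1 = j by omega, show m + (j + 2) - (j + 1) - 1 = m by omega]
  set v : ℕ → ℕ := fun i => w (j + 2 + m + 1 - i) with hv
  have hv1 : ∀ i, 1 ≤ v i := fun i => hw _
  have ew := contQShift_add (w := w) (z := v) (k := j + 2) (m := m) fun i _ _ => rfl
  have ez := contQShift_add (w := z) (z := v) (k := j + 2) (m := m) fun i hi him =>
    (hout _ (by omega) (by omega) (by omega) (by omega)).symm
  have c1 : contQShift z (j + 1) = contQShift w (j + 1) :=
    contQShift_congr fun i hi hij => hout i hi (by omega) (by omega) (by omega)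
  have c0 : contQShift z j = contQShift w j :=
    contQShift_congr fun i hi hij => hout i hi (by omega) (by omega) (by omega)
  rw [contQShift.eq_3 _ (j + 1), contQShift.eq_3 _ j] at ew
  rw [contQShift.eq_3 _ (j + 1), contQShift.eq_3 _ j, c1, c0, hswap, hswap'] at ez
  have key := abs_contQShift_cross_le hw hv1 j m fun i hij him => by
    have := hpal (i + 1) (by omega) (by omega) (by omega)
    rw [show j + 1 - (i + 1) = j - i by omega] at this
    rw [this, hv]
    simp only
    congr 1; omega
  have hA : (0 : ℝ) < contQShift w (j + 1) := by exact_mod_cast contQShift_succ_pos hw j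
  have hB : (0 : ℝ) < contQShift v (m + 1) := by exact_mod_cast contQShift_succ_pos hv1 m
  have hP : (1 : ℝ) ≤ w (j + 1) := by exact_mod_cast hw _
  have hP' : (w (j + 1) : ℝ) ≤ a := by exact_mod_cast hwa _
  have hR : (1 : ℝ) ≤ w (j + 1 + 1) := by exact_mod_cast hw _
  have hR' : (w (j + 1 + 1) : ℝ) ≤ a := by exact_mod_cast hwa _
  rw [contQ_eq_contQShift, contQ_eq_contQShift, show m + (j + 2) + 1 = j + 2 + m + 1 by ring,
    ew, ez]
  clear ew ez c1 c0
  generalize contQShift w (j + 1) = A at *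
  generalize contQShift v (m + 1) = B at *
  generalize contQShift w j = A' at *
  generalize contQShift v m = B' at *
  generalize w (j + 1) = p at *
  generalize w (j + 1 + 1) = q at *
  push_cast
  have hA' : (0 : ℝ) ≤ A' := Nat.cast_nonneg _
  have hB' : (0 : ℝ) ≤ B' := Nat.cast_nonneg _
  refine abs_log_sub_log_le (c := A * B) (by positivity) ?_ ?_ ?_
  · have : (0 : ℝ) ≤ q * (p * A + A') * B + (p * A + A') * B' := by positivity
    linarith
  · have : (0 : ℝ) ≤ p * (q * A + A') * B + (q * A + A') * B' := by positivity
    linarith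
  · have e : ((q * (p * A + A') + A) * B + (p * A + A') * B' : ℝ) -
        ((p * (q * A + A') + A) * B + (q * A + A') * B') = (q - p) * (A' * B - A * B') := by ring
    rw [e, abs_mul]
    have hqp : |(q : ℝ) - p| ≤ a := by
      rw [abs_le]; constructor <;> linarith
    have hpow : |(A' * B - A * B' : ℝ)| ≤ 2 * (A * B) * (1 / 2) ^ min j m := by
      rw [one_div, inv_pow, ← div_eq_mul_inv, le_div_iff₀ (by positivity)]
      exact key
    calc _ ≤ (a : ℝ) * (2 * (A * B) * (1 / 2) ^ min j m) := by gcongr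
      _ = _ := by ring

theorem abs_log_contQ_last_le {w z : ℕ → ℕ} {a : ℕ} (hw : ∀ i, 1 ≤ w i) (hz : ∀ i, 1 ≤ z i)
    (hwa : ∀ i, w i ≤ a) (hza : ∀ i, z i ≤ a) {n : ℕ}
    (hout : ∀ i, 1 ≤ i → i < n → z i = w i) :
    |Real.log (contQ w n) - Real.log (contQ z n)| ≤ a := by
  cases n with
  | zero => simp [contQ]
  | succ n =>
    have c1 : contQShift z (n + 1) = contQShift w (n + 1) :=
      contQShift_congr fun i hi hin => hout i hi (by omega)
    have c0 : contQShift z n = contQShift w n :=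
      contQShift_congr fun i hi hin => hout i hi (by omega)
    rw [contQ_eq_contQShift, contQ_eq_contQShift, contQShift, contQShift, c1, c0]
    have hA : (1 : ℝ) ≤ contQShift w (n + 1) := by exact_mod_cast contQShift_succ_pos hw n
    have hA' : (0 : ℝ) ≤ contQShift w n := Nat.cast_nonneg _
    have hP : (1 : ℝ) ≤ w (n + 1) := by exact_mod_cast hw _
    have hP' : (w (n + 1) : ℝ) ≤ a := by exact_mod_cast hwa _
    have hR : (1 : ℝ) ≤ z (n + 1) := by exact_mod_cast hz _
    have hR' : (z (n + 1) : ℝ) ≤ a := by exact_mod_cast hza _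
    push_cast
    refine abs_log_sub_log_le (c := contQShift w (n + 1)) (by linarith) (by nlinarith)
      (by nlinarith) ?_
    rw [add_sub_add_right_eq_sub, ← sub_mul, abs_mul,
      abs_of_nonneg (by linarith : (0 : ℝ) ≤ contQShift w (n + 1))]
    gcongr
    rw [abs_le]; constructor <;> linarith

/-- The letter of a mechanical word over `{1, a}` coded by an increment of the floors. -/
def mechLetter (a : ℕ) (d : ℤ) : ℕ := if d = 0 then 1 else a

theorem one_le_mechLetter {a : ℕ} (ha : 1 ≤ a) (d : ℤ) : 1 ≤ mechLetter a d := by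
  unfold mechLetter; split_ifs <;> omega

theorem mechLetter_le {a : ℕ} (ha : 1 ≤ a) (d : ℤ) : mechLetter a d ≤ a := by
  unfold mechLetter; split_ifs <;> omega

theorem mechWord_eq_mechLetter (a : ℕ) (θ ρ : ℝ) (n : ℕ) :
    mechWord 1 a θ ρ n = mechLetter a (⌊(n : ℝ) * θ + ρ⌋ - ⌊((n : ℝ) - 1) * θ + ρ⌋) := rfl

/-- The word coded by the increments of the sequence `⌊i θ⌋ + 1_S(i)`. -/
noncomputable def raisedWord (a : ℕ) (θ : ℝ) (S : Finset ℕ) (i : ℕ) : ℕ :=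
  mechLetter a ((⌊(i : ℝ) * θ⌋ + if i ∈ S then 1 else 0) -
    (⌊((i - 1 : ℕ) : ℝ) * θ⌋ + if i - 1 ∈ S then 1 else 0))

/-- The intercept at which `⌊k θ + x⌋` jumps from `⌊k θ⌋` to `⌊k θ⌋ + 1`. -/
noncomputable def jumpPoint (θ : ℝ) (k : ℕ) : ℝ := 1 - Int.fract ((k : ℝ) * θ)

theorem floor_add_eq_of_jumpPoint (θ : ℝ) (k : ℕ) {x : ℝ} (h0 : 0 ≤ x) (h1 : x < 1) :
    ⌊(k : ℝ) * θ + x⌋ = ⌊(k : ℝ) * θ⌋ + if jumpPoint θ k ≤ x then 1 else 0 := by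
  have e := Int.floor_add_fract ((k : ℝ) * θ)
  have f0 := Int.fract_nonneg ((k : ℝ) * θ)
  have f1 := Int.fract_lt_one ((k : ℝ) * θ)
  unfold jumpPoint
  rw [Int.floor_eq_iff]
  split_ifs with h <;> push_cast <;> constructor <;> linarith

theorem jumpPoint_injective {θ : ℝ} (hθ : Irrational θ) : Function.Injective (jumpPoint θ) := by
  intro i j hij
  have h : Int.fract ((i : ℝ) * θ) = Int.fract ((j : ℝ) * θ) := by
    unfold jumpPoint at hij; linarith
  obtain ⟨z, hz⟩ := Int.fract_eq_fract.1 h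
  by_contra hne
  have hne' : ((i : ℤ) - j) ≠ 0 := by omega
  have := hθ.intCast_mul hne'
  refine this ⟨z, ?_⟩
  push_cast
  linarith

theorem Irrational.floor_neg {y : ℝ} (hy : Irrational y) : ⌊-y⌋ = -⌊y⌋ - 1 := by
  rw [Int.floor_eq_iff]
  have h1 := Int.floor_le y
  have h2 := Int.lt_floor_add_one y
  have h3 : (⌊y⌋ : ℝ) ≠ y := fun h => hy ⟨⌊y⌋, by exact_mod_cast h⟩
  have h4 := lt_of_le_of_ne h1 h3
  push_cast
  constructor <;> linarith

theorem abs_log_contQ_raisedWord_insert_le {a : ℕ} (ha : 1 ≤ a) {θ : ℝ} (hθ : Irrational θ)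
    {n k : ℕ} {s : Finset ℕ} (hk1 : 1 ≤ k) (hkn : k ≤ n) (hks : k ∉ s)
    (hs : ∀ i, i ≤ n → (i ∈ insert k s ↔ 1 ≤ i ∧ jumpPoint θ i ≤ jumpPoint θ k)) :
    |Real.log (contQ (raisedWord a θ (insert k s)) n) - Real.log (contQ (raisedWord a θ s) n)| ≤
      2 * a * (1 / 2) ^ min (k - 1) (n - k - 1) := by
  have hmul : ∀ i : ℕ, 1 ≤ i → Irrational ((i : ℝ) * θ) := fun i hi =>
    hθ.natCast_mul (by omega)
  have hkfract : 0 < Int.fract ((k : ℝ) * θ) :=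
    lt_of_le_of_ne (Int.fract_nonneg _) fun h => (hmul k hk1) (by
      refine ⟨⌊(k : ℝ) * θ⌋, ?_⟩
      have := Int.floor_add_fract ((k : ℝ) * θ)
      push_cast; linarith)
  have hc1 : jumpPoint θ k < 1 := by unfold jumpPoint; linarith
  have hc0 : 0 ≤ jumpPoint θ k := by
    have := Int.fract_lt_one ((k : ℝ) * θ)
    unfold jumpPoint; linarith
  have hM : (k : ℝ) * θ + jumpPoint θ k = (⌊(k : ℝ) * θ⌋ + 1 : ℤ) := by
    have := Int.floor_add_fract ((k : ℝ) * θ)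
    unfold jumpPoint; push_cast; linarith
  set M : ℤ := ⌊(k : ℝ) * θ⌋ + 1 with hMdef
  have hF : ∀ i, i ≤ n → (⌊(i : ℝ) * θ⌋ + if i ∈ insert k s then 1 else 0 : ℤ) =
      ⌊((i : ℝ) - k) * θ⌋ + M := by
    intro i hi
    have e1 : ((i : ℝ) - k) * θ = (i * θ + jumpPoint θ k) - (M : ℤ) := by rw [← hM]; ring
    rw [e1, Int.floor_sub_intCast, sub_add_cancel, floor_add_eq_of_jumpPoint θ i hc0 hc1]
    congr 1
    rcases Nat.eq_zero_or_pos i with rfl | hi0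
    · have hn : ¬ jumpPoint θ 0 ≤ jumpPoint θ k := by
        have : jumpPoint θ 0 = 1 := by simp [jumpPoint]
        linarith
      simp only [hs 0 hi, hn, and_false]
    · simp only [hs i hi, show 1 ≤ i from hi0, true_and]
  have hG : ∀ i, i ≤ n → (⌊(i : ℝ) * θ⌋ + if i ∈ s then 1 else 0 : ℤ) =
      ⌊((i : ℝ) - k) * θ⌋ + M - if i = k then 1 else 0 := by
    intro i hi
    rw [← hF i hi]
    by_cases hik : i = k
    · subst hik; simp [hks]
    · simp [hik]
  have hw : ∀ i, 1 ≤ i → i ≤ n → raisedWord a θ (insert k s) i =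
      mechLetter a (⌊((i : ℝ) - k) * θ⌋ - ⌊((i : ℝ) - 1 - k) * θ⌋) := by
    intro i hi hin
    unfold raisedWord
    rw [hF i hin, hF (i - 1) (by omega)]
    push_cast [hi]
    rw [add_sub_add_right_eq_sub]
  have hz : ∀ i, 1 ≤ i → i ≤ n → raisedWord a θ s i =
      mechLetter a (⌊((i : ℝ) - k) * θ⌋ - (if i = k then 1 else 0) -
        (⌊((i : ℝ) - 1 - k) * θ⌋ - if i = k + 1 then 1 else 0)) := by
    intro i hi hin
    unfold raisedWord
    rw [hG i hin, hG (i - 1) (by omega)]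
    have : i - 1 = k ↔ i = k + 1 := by omega
    push_cast [hi]
    simp only [this]
    congr 1
    ring
  have hout : ∀ i, 1 ≤ i → i ≤ n → i ≠ k → i ≠ k + 1 →
      raisedWord a θ s i = raisedWord a θ (insert k s) i := by
    intro i hi hin hik hik'
    rw [hw i hi hin, hz i hi hin]
    simp [hik, hik']
  have hw1 : ∀ S i, 1 ≤ raisedWord a θ S i := fun S i => one_le_mechLetter ha _
  have hwa : ∀ S i, raisedWord a θ S i ≤ a := fun S i => mechLetter_le ha _
  rcases hkn.eq_or_lt with rfl | hlt
  · refine (abs_log_contQ_last_le (hw1 _) (hw1 _) (hwa _) (hwa _)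
      fun i hi hik => hout i hi hik.le hik.ne (by omega)).trans ?_
    have : (0 : ℝ) ≤ a := Nat.cast_nonneg _
    simp only [Nat.sub_self, Nat.zero_sub, Nat.min_zero, pow_zero]
    linarith
  · have hneg : ⌊-θ⌋ = -⌊θ⌋ - 1 := hθ.floor_neg
    refine abs_log_contQ_swap_le (hw1 _) (hwa _) hk1 hlt hout ?_ ?_ ?_
    · rw [hz k hk1 hkn, hw (k + 1) (by omega) hlt]
      push_cast
      rw [show ((k : ℝ) - k) * θ = 0 by ring, show ((k : ℝ) - 1 - k) * θ = -θ by ring,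
        show ((k : ℝ) + 1 - k) * θ = θ by ring, show ((k : ℝ) + 1 - 1 - k) * θ = 0 by ring, hneg]
      congr 1
      simp only [Int.floor_zero, if_true, left_eq_add, one_ne_zero, if_false]
      ring
    · rw [hz (k + 1) (by omega) hlt, hw k hk1 hkn]
      push_cast
      rw [show ((k : ℝ) - k) * θ = 0 by ring, show ((k : ℝ) - 1 - k) * θ = -θ by ring,
        show ((k : ℝ) + 1 - k) * θ = θ by ring, show ((k : ℝ) + 1 - 1 - k) * θ = 0 by ring, hneg]
      congr 1
      simp [add_comm]
    · intro i hi hik hkin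
      rw [hw (k - i) (by omega) (by omega), hw (k + 1 + i) (by omega) hkin]
      have e1 := (hmul i hi).floor_neg
      have e2 := (hmul (i + 1) (by omega)).floor_neg
      push_cast [hik.le] at e2 ⊢
      rw [show ((k : ℝ) - i - k) * θ = -(i * θ) by ring,
        show ((k : ℝ) - i - 1 - k) * θ = -((i + 1) * θ) by ring,
        show ((k : ℝ) + 1 + i - k) * θ = (i + 1) * θ by ring,
        show ((k : ℝ) + 1 + i - 1 - k) * θ = i * θ by ring, e1, e2]
      congr 1
      ring

theorem abs_log_contQ_raisedWord_le {a : ℕ} (ha : 1 ≤ a) {θ : ℝ} (hθ : Irrational θ)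
    (n : ℕ) (s : Finset ℕ) (hs : s ⊆ Finset.Icc 1 n)
    (hlower : ∀ i ∈ s, ∀ j ∈ Finset.Icc 1 n, jumpPoint θ j ≤ jumpPoint θ i → j ∈ s) :
    |Real.log (contQ (raisedWord a θ s) n) - Real.log (contQ (raisedWord a θ ∅) n)| ≤
      ∑ k ∈ s, 2 * (a : ℝ) * (1 / 2) ^ min (k - 1) (n - k - 1) := by
  induction s using Finset.induction_on_max_value (jumpPoint θ) with
  | empty => simp
  | insert k s hks hmax ih =>
    have hk := Finset.mem_Icc.1 (hs (Finset.mem_insert_self k s))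
    have h1 := abs_log_contQ_raisedWord_insert_le ha hθ hk.1 hk.2 hks (fun i hi => by
      constructor
      · intro his
        refine ⟨(Finset.mem_Icc.1 (hs his)).1, ?_⟩
        rcases Finset.mem_insert.1 his with rfl | h
        · exact le_rfl
        · exact hmax i h
      · rintro ⟨h1, h2⟩
        exact hlower k (Finset.mem_insert_self k s) i (Finset.mem_Icc.2 ⟨h1, hi⟩) h2)
    have h2 := ih ((Finset.subset_insert k s).trans hs) (fun i hi j hj hji => by
      rcases Finset.mem_insert.1 (hlower i (Finset.mem_insert_of_mem hi) j hj hji) with rfl | h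
      · have := jumpPoint_injective hθ (le_antisymm hji (hmax i hi))
        exact this ▸ hi
      · exact h)
    rw [Finset.sum_insert hks]
    refine (abs_sub_le _ (Real.log (contQ (raisedWord a θ s) n)) _).trans ?_
    exact add_le_add h1 h2

theorem sum_two_mul_half_pow_min_le (a n : ℕ) :
    ∑ k ∈ Finset.Icc 1 n, 2 * (a : ℝ) * (1 / 2) ^ min (k - 1) (n - k - 1) ≤ 12 * a := by
  have hg : ∀ m, ∑ i ∈ Finset.range m, (1 / 2 : ℝ) ^ i ≤ 2 := sum_geometric_two_le
  have h1 : ∑ k ∈ Finset.Icc 1 n, (1 / 2 : ℝ) ^ min (k - 1) (n - k - 1) ≤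
      ∑ i ∈ Finset.range n, ((1 / 2 : ℝ) ^ i + 2 * (1 / 2) ^ (n - 1 - i)) := by
    rw [Finset.range_eq_Ico, Finset.sum_Ico_eq_sum_range, ← Finset.Ico_add_one_right_eq_Icc,
      Finset.sum_Ico_eq_sum_range]
    refine Finset.sum_le_sum fun i _ => ?_
    simp only [Nat.zero_add, Nat.add_sub_cancel_left]
    rcases min_choice i (n - (1 + i) - 1) with h | h <;> rw [h]
    · have : (0 : ℝ) ≤ 2 * (1 / 2) ^ (n - 1 - i) := by positivity
      linarith
    · have h2 : (2 : ℝ) * (1 / 2) ^ (n - 1 - i) ≥ (1 / 2) ^ (n - (1 + i) - 1) := by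
        rcases Nat.eq_zero_or_pos (n - 1 - i) with h0 | h0
        · rw [h0, show n - (1 + i) - 1 = 0 by omega]; norm_num
        · rw [show n - 1 - i = (n - (1 + i) - 1) + 1 by omega, pow_succ]; linarith
      have : (0 : ℝ) ≤ (1 / 2) ^ i := by positivity
      linarith
  rw [Finset.sum_add_distrib, ← Finset.mul_sum,
    Finset.sum_range_reflect (fun i => (1 / 2 : ℝ) ^ i) n] at h1
  rw [← Finset.mul_sum]
  have : (0 : ℝ) ≤ a := Nat.cast_nonneg _
  nlinarith [hg n]

theorem one_le_mechWord {a : ℕ} (ha : 1 ≤ a) (θ x : ℝ) (i : ℕ) : 1 ≤ mechWord 1 a θ x i :=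
  one_le_mechLetter ha _

theorem mechWord_congr_floor {a : ℕ} {θ η x y : ℝ} {n : ℕ}
    (h : ∀ k : ℕ, k ≤ n → ⌊(k : ℝ) * θ + x⌋ = ⌊(k : ℝ) * η + y⌋) :
    contQ (mechWord 1 a θ x) n = contQ (mechWord 1 a η y) n := by
  refine contQ_congr fun i hi hin => ?_
  have h1 := h (i - 1) (by omega)
  push_cast [hi] at h1
  rw [mechWord_eq_mechLetter, mechWord_eq_mechLetter, h i hin, h1]

theorem contQ_mechWord_eq_raisedWord {a : ℕ} (θ : ℝ) (n : ℕ) {x : ℝ} (h0 : 0 ≤ x) (h1 : x < 1) :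
    contQ (mechWord 1 a θ x) n =
      contQ (raisedWord a θ ((Finset.Icc 1 n).filter fun k => jumpPoint θ k ≤ x)) n := by
  have hF : ∀ i : ℕ, i ≤ n → ⌊(i : ℝ) * θ + x⌋ = ⌊(i : ℝ) * θ⌋ +
      if i ∈ (Finset.Icc 1 n).filter fun k => jumpPoint θ k ≤ x then 1 else 0 := by
    intro i hi
    rw [floor_add_eq_of_jumpPoint θ i h0 h1]
    congr 1
    rcases Nat.eq_zero_or_pos i with rfl | hi0
    · have hn : ¬ jumpPoint θ 0 ≤ x := by
        have : jumpPoint θ 0 = 1 := by simp [jumpPoint]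
        linarith
      simp [hn]
    · simp only [Finset.mem_filter, Finset.mem_Icc, show 1 ≤ i from hi0, hi, true_and]
  refine contQ_congr fun i hi hin => ?_
  have h2 := hF (i - 1) (by omega)
  rw [mechWord_eq_mechLetter, raisedWord, hF i hin, ← h2]
  push_cast [hi]
  rfl

theorem abs_log_contQ_mechWord_sub_le_of_irrational {a : ℕ} (ha : 1 ≤ a) {θ : ℝ}
    (hθ : Irrational θ) (n : ℕ) (x : ℝ) :
    |Real.log (contQ (mechWord 1 a θ x) n) - Real.log (contQ (mechWord 1 a θ 0) n)| ≤ 12 * a := by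
  have hx : contQ (mechWord 1 a θ x) n = contQ (mechWord 1 a θ (Int.fract x)) n := by
    refine contQ_congr fun i _ _ => ?_
    rw [mechWord_eq_mechLetter, mechWord_eq_mechLetter]
    conv_lhs => rw [← Int.fract_add_floor x, ← add_assoc, ← add_assoc, Int.floor_add_intCast,
      Int.floor_add_intCast, add_sub_add_right_eq_sub]
  have h0 : (Finset.Icc 1 n).filter (fun k => jumpPoint θ k ≤ 0) = ∅ := by
    refine Finset.filter_eq_empty_iff.2 fun k _ => ?_
    have := Int.fract_lt_one ((k : ℝ) * θ)
    unfold jumpPoint; linarith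
  rw [hx, contQ_mechWord_eq_raisedWord θ n (Int.fract_nonneg x) (Int.fract_lt_one x),
    contQ_mechWord_eq_raisedWord θ n le_rfl one_pos, h0]
  refine (abs_log_contQ_raisedWord_le ha hθ n _ (Finset.filter_subset _ _) ?_).trans ?_
  · intro i hi j hj hji
    exact Finset.mem_filter.2 ⟨hj, hji.trans (Finset.mem_filter.1 hi).2⟩
  · refine le_trans (Finset.sum_le_sum_of_subset_of_nonneg (Finset.filter_subset _ _) ?_)
      (sum_two_mul_half_pow_min_le a n)
    intros; positivity

theorem eventually_floor_mul_add_eq_nhdsGT (θ x : ℝ) (k : ℕ) :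
    ∀ᶠ η in nhdsWithin θ (Set.Ioi θ), ⌊(k : ℝ) * η + x⌋ = ⌊(k : ℝ) * θ + x⌋ := by
  have hlt : ∀ᶠ η in nhds θ, (k : ℝ) * η + x < ⌊(k : ℝ) * θ + x⌋ + 1 :=
    ContinuousAt.eventually_lt (f := fun η : ℝ => (k : ℝ) * η + x) (by fun_prop)
      continuousAt_const (Int.lt_floor_add_one _)
  filter_upwards [hlt.filter_mono nhdsWithin_le_nhds, self_mem_nhdsWithin] with η h1 h2
  rw [Int.floor_eq_iff]
  refine ⟨(Int.floor_le ((k : ℝ) * θ + x)).trans ?_, h1⟩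
  have : θ ≤ η := le_of_lt h2
  gcongr

theorem abs_log_contQ_mechWord_sub_le {a : ℕ} (ha : 1 ≤ a) (θ : ℝ) (n : ℕ) (x : ℝ) :
    |Real.log (contQ (mechWord 1 a θ x) n) - Real.log (contQ (mechWord 1 a θ 0) n)| ≤ 12 * a := by
  have hev : ∀ y : ℝ, ∀ᶠ η in nhdsWithin θ (Set.Ioi θ), ∀ k ∈ Finset.range (n + 1),
      ⌊(k : ℝ) * θ + y⌋ = ⌊(k : ℝ) * η + y⌋ := fun y =>
    (Filter.eventually_all_finset _).2 fun k _ =>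
      (eventually_floor_mul_add_eq_nhdsGT θ y k).mono fun _ h => h.symm
  obtain ⟨u, hu, hsub⟩ := mem_nhdsGT_iff_exists_Ioo_subset.1 ((hev x).and (hev 0))
  obtain ⟨η, hη, h1, h2⟩ := exists_irrational_btwn hu
  obtain ⟨e1, e2⟩ := hsub ⟨h1, h2⟩
  rw [mechWord_congr_floor fun k hk => e1 k (Finset.mem_range.2 (by omega)),
    mechWord_congr_floor fun k hk => e2 k (Finset.mem_range.2 (by omega))]
  exact abs_log_contQ_mechWord_sub_le_of_irrational ha hη n x

theorem abs_le_mul_of_quasiadditive {u : ℕ → ℝ} {C : ℝ}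
    (h : ∀ m n, |u (m + n) - u m - u n| ≤ C) (n : ℕ) : |u (n + 1)| ≤ (n + 1) * (|u 1| + C) := by
  have hC : 0 ≤ C := (abs_nonneg _).trans (h 0 0)
  induction n with
  | zero => simp [hC]
  | succ n ih =>
    have e : u (n + 1 + 1) = (u (n + 1 + 1) - u (n + 1) - u 1) + u (n + 1) + u 1 := by ring
    rw [e]
    refine (abs_add_three _ _ _).trans ?_
    push_cast
    linarith [h (n + 1) 1]

theorem subadditive_add_const_of_quasiadditive {u : ℕ → ℝ} {C : ℝ}
    (h : ∀ m n, |u (m + n) - u m - u n| ≤ C) : Subadditive fun n => u n + C := by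
  intro m n
  linarith [(abs_le.1 (h m n)).2]

theorem bddBelow_div_of_quasiadditive {u : ℕ → ℝ} {C : ℝ}
    (h : ∀ m n, |u (m + n) - u m - u n| ≤ C) :
    BddBelow (Set.range fun n : ℕ => (u n + C) / n) := by
  have hC : 0 ≤ C := (abs_nonneg _).trans (h 0 0)
  refine ⟨-(|u 1| + C), ?_⟩
  rintro _ ⟨n, rfl⟩
  cases n with
  | zero =>
    have := abs_nonneg (u 1)
    simp only [CharP.cast_eq_zero, div_zero]
    linarith
  | succ n =>
    have h1 := (abs_le.1 (abs_le_mul_of_quasiadditive h n)).1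
    simp only
    rw [le_div_iff₀ (by positivity)]
    push_cast
    linarith

theorem tendsto_div_of_quasiadditive {u : ℕ → ℝ} {C : ℝ}
    (h : ∀ m n, |u (m + n) - u m - u n| ≤ C) :
    ∃ ℓ, Tendsto (fun n : ℕ => u n / n) atTop (nhds ℓ) ∧ ∀ n : ℕ, u n ≥ n * ℓ - C := by
  have hs := subadditive_add_const_of_quasiadditive h
  have hb := bddBelow_div_of_quasiadditive h
  have ht := hs.tendsto_lim hb
  refine ⟨hs.lim, ?_, fun n => ?_⟩
  · have h0 := ht.sub (tendsto_const_div_atTop_nhds_zero_nat C)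
    rw [sub_zero] at h0
    refine h0.congr fun n => ?_
    rw [← sub_div, add_sub_cancel_right]
  · rcases Nat.eq_zero_or_pos n with rfl | hn
    · have := (abs_le.1 (h 0 0)).2
      simp only [Nat.add_zero] at this
      simp only [CharP.cast_eq_zero, zero_mul, zero_sub, ge_iff_le]
      linarith
    · have := hs.lim_le_div hb hn.ne'
      have hn' : (0 : ℝ) < n := by exact_mod_cast hn
      rw [le_div_iff₀ hn'] at this
      linarith

/-- A sequence that is additive up to a bounded error is linear up to a bounded error. -/
theorem exists_tendsto_div_of_quasiadditive {u : ℕ → ℝ} {C : ℝ}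
    (h : ∀ m n, |u (m + n) - u m - u n| ≤ C) :
    ∃ ℓ, Tendsto (fun n : ℕ => u n / n) atTop (nhds ℓ) ∧ ∀ n : ℕ, |u n - n * ℓ| ≤ C := by
  obtain ⟨ℓ, h1, h2⟩ := tendsto_div_of_quasiadditive h
  obtain ⟨m, h3, h4⟩ := tendsto_div_of_quasiadditive (u := fun n => -u n) (C := C) fun i j => by
    rw [← abs_neg]
    convert h i j using 2
    ring
  have hm : m = -ℓ := tendsto_nhds_unique h3 (by simpa [neg_div] using h1.neg)
  subst hm
  refine ⟨ℓ, h1, fun n => ?_⟩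
  rw [abs_le]
  constructor <;> linarith [h2 n, h4 n]

theorem mechWord_add_left (a : ℕ) (θ x : ℝ) (k i : ℕ) :
    mechWord 1 a θ x (k + i) = mechWord 1 a θ (k * θ + x) i := by
  simp only [mechWord]
  push_cast
  ring_nf

theorem exists_hasLevyConstant_mechWord {a : ℕ} (ha : 1 ≤ a) (θ : ℝ) :
    ∃ ℓ, HasLevyConstant (mechWord 1 a θ 0) ℓ ∧
      ∀ (n : ℕ) (x : ℝ), |Real.log (contQ (mechWord 1 a θ x) n) - n * ℓ| ≤ 24 * a + 1 := by
  obtain ⟨ℓ, h1, h2⟩ := exists_tendsto_div_of_quasiadditive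
    (u := fun n => Real.log (contQ (mechWord 1 a θ 0) n)) (C := 12 * a + 1) fun m n => by
      have e1 := abs_le.1 (abs_log_contQ_add_le (one_le_mechWord ha θ 0) m n)
      simp only [mechWord_add_left] at e1
      have e2 := abs_le.1 (abs_log_contQ_mechWord_sub_le ha θ n (m * θ + 0))
      rw [abs_le]
      constructor <;> linarith
  refine ⟨ℓ, h1, fun n x => ?_⟩
  have e1 := abs_le.1 (h2 n)
  have e2 := abs_le.1 (abs_log_contQ_mechWord_sub_le ha θ n x)
  rw [abs_le]
  constructor <;> linarith

theorem exists_forall_mul_add_ne_intCast (θ : ℝ) :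
    ∃ x : ℝ, ∀ (k : ℕ) (m : ℤ), (k : ℝ) * θ + x ≠ m := by
  have hc : (Set.range fun p : ℕ × ℤ => (p.2 : ℝ) - p.1 * θ).Countable := Set.countable_range _
  obtain ⟨x, hx⟩ := (hc.dense_compl ℝ).nonempty
  refine ⟨x, fun k m h => hx ⟨(k, m), ?_⟩⟩
  simp only
  linarith

theorem eventually_floor_mul_add_eq_nhds {θ x : ℝ} {k : ℕ}
    (h : ∀ m : ℤ, (k : ℝ) * θ + x ≠ m) :
    ∀ᶠ η in nhds θ, ⌊(k : ℝ) * η + x⌋ = ⌊(k : ℝ) * θ + x⌋ := by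
  have hc : ContinuousAt (fun η : ℝ => (k : ℝ) * η + x) θ := by fun_prop
  have h1 := hc.eventually_lt continuousAt_const (Int.lt_floor_add_one ((k : ℝ) * θ + x))
  have h2 := continuousAt_const.eventually_lt hc
    (lt_of_le_of_ne (Int.floor_le ((k : ℝ) * θ + x)) (h _).symm)
  filter_upwards [h1, h2] with η h1 h2
  rw [Int.floor_eq_iff]
  exact ⟨h2.le, h1⟩

theorem continuous_of_abs_log_contQ_sub_le {a : ℕ} {ℓ : ℝ → ℝ} {C : ℝ}
    (h : ∀ (θ : ℝ) (n : ℕ) (x : ℝ),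
      |Real.log (contQ (mechWord 1 a θ x) n) - n * ℓ θ| ≤ C) : Continuous ℓ := by
  rw [continuous_iff_continuousAt]
  intro θ
  rw [Metric.continuousAt_iff']
  intro ε hε
  obtain ⟨n, hn⟩ := exists_nat_gt (2 * C / ε)
  obtain ⟨x, hx⟩ := exists_forall_mul_add_ne_intCast θ
  have hev : ∀ᶠ η in nhds θ, ∀ k ∈ Finset.range (n + 1),
      ⌊(k : ℝ) * η + x⌋ = ⌊(k : ℝ) * θ + x⌋ :=
    (Filter.eventually_all_finset _).2 fun k _ => eventually_floor_mul_add_eq_nhds (hx k)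
  filter_upwards [hev] with η hη
  have e1 := abs_le.1 (h η n x)
  have e2 := abs_le.1 (h θ n x)
  rw [mechWord_congr_floor fun k hk => hη k (Finset.mem_range.2 (by omega))] at e1
  have hC : 0 ≤ C := (abs_nonneg _).trans (h θ n x)
  have hn0 : (0 : ℝ) < n := lt_of_le_of_lt (by positivity) hn
  rw [div_lt_iff₀ hε] at hn
  rw [Real.dist_eq, abs_lt]
  constructor <;> nlinarith

theorem HasLevyConstant.le_log_of_contQ_le {w : ℕ → ℕ} {ℓ r : ℝ} (h : HasLevyConstant w ℓ)
    (hw : ∀ i, 1 ≤ w i) (hle : ∀ n, (contQ w n : ℝ) ≤ r ^ n) : ℓ ≤ Real.log r := by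
  refine le_of_tendsto h ?_
  filter_upwards [eventually_gt_atTop 0] with n hn
  have hn' : (0 : ℝ) < n := by exact_mod_cast hn
  have hpos : (0 : ℝ) < contQ w n := by exact_mod_cast contQ_pos hw n
  rw [div_le_iff₀ hn', mul_comm, ← Real.log_pow]
  exact Real.log_le_log hpos (hle n)

theorem HasLevyConstant.log_le_of_le_contQ {w : ℕ → ℕ} {ℓ r : ℝ} (h : HasLevyConstant w ℓ)
    (hr : 0 < r) (hle : ∀ n, r ^ n ≤ r * contQ w n) : Real.log r ≤ ℓ := by
  have h1 : Tendsto (fun n : ℕ => Real.log r / n + Real.log (contQ w n) / n) atTop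
      (nhds (0 + ℓ)) := (tendsto_const_div_atTop_nhds_zero_nat _).add h
  rw [zero_add] at h1
  refine ge_of_tendsto h1 ?_
  filter_upwards [eventually_gt_atTop 0] with n hn
  have hn' : (0 : ℝ) < n := by exact_mod_cast hn
  have hpos : (0 : ℝ) < contQ w n := by
    have : 0 < r * contQ w n := (pow_pos hr n).trans_le (hle n)
    exact (pos_iff_pos_of_mul_pos this).1 hr
  have := Real.log_le_log (pow_pos hr n) (hle n)
  rw [Real.log_pow, Real.log_mul hr.ne' hpos.ne'] at this
  rw [← add_div, le_div_iff₀ hn']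
  linarith

theorem mechWord_slope_zero (a n : ℕ) : mechWord 1 a 0 0 n = 1 := by
  simp [mechWord]

theorem mechWord_slope_one (a n : ℕ) : mechWord 1 a 1 0 n = a := by
  simp [mechWord]

theorem contQ_le_two_pow {w : ℕ → ℕ} (hw : ∀ i, w i = 1) (n : ℕ) :
    (contQ w n : ℝ) ≤ 2 ^ n := by
  induction n using Nat.twoStepInduction with
  | zero => simp [contQ]
  | one => simp [contQ, hw]
  | more n h1 h2 =>
    rw [contQ, hw]
    push_cast
    have : (0 : ℝ) < 2 ^ n := by positivity
    rw [pow_succ] at h2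
    rw [pow_add]
    linarith

theorem pow_le_mul_contQ {w : ℕ → ℕ} (hw : ∀ i, 3 ≤ w i) (n : ℕ) :
    (3.3 : ℝ) ^ n ≤ 3.3 * contQ w n := by
  have hw' : ∀ i, (3 : ℝ) ≤ w i := fun i => by exact_mod_cast hw i
  induction n using Nat.twoStepInduction with
  | zero => norm_num [contQ]
  | one =>
    have := hw' 1
    simp only [contQ]
    linarith
  | more n h1 h2 =>
    rw [contQ]
    push_cast
    have h3 : (0 : ℝ) ≤ contQ w (n + 1) := Nat.cast_nonneg _
    have h4 := mul_le_mul_of_nonneg_right (hw' (n + 2)) h3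
    have : (0 : ℝ) < 3.3 ^ n := by positivity
    rw [pow_succ] at h2
    rw [pow_add]
    linarith

theorem log_two_le_levy : Real.log 2 ≤ Real.pi ^ 2 / (12 * Real.log 2) := by
  have h1 := Real.log_two_gt_d9
  have h2 := Real.log_two_lt_d9
  have h3 := Real.pi_gt_three
  rw [le_div_iff₀ (by linarith)]
  nlinarith

theorem levy_le_log : Real.pi ^ 2 / (12 * Real.log 2) ≤ Real.log 3.3 := by
  have h1 := Real.log_two_gt_d9
  have h3 := Real.pi_lt_d4
  have h4 := Real.pi_pos
  have h5 : (1.19 : ℝ) ≤ Real.log 3.3 := by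
    rw [Real.le_log_iff_exp_le (by norm_num), show (1.19 : ℝ) = 1 + 0.19 by norm_num, Real.exp_add]
    have e1 := Real.exp_one_lt_d9
    have e2 := Real.exp_bound' (x := 0.19) (n := 4) (by norm_num) (by norm_num) (by norm_num)
    norm_num [Finset.sum_range_succ, Nat.factorial] at e2
    have e3 := Real.exp_pos 1
    have e4 := Real.exp_pos 0.19
    nlinarith
  refine le_trans ?_ h5
  rw [div_le_iff₀ (by linarith)]
  nlinarith

/-- For an integer `a ≥ 3`, there is a slope `θ ∈ [0,1]` such that the
mechanical continued fraction `[0; s_{θ,0}]` over `{1, a}` with intercept `0` has Lévy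
constant `π² / (12 log 2)`. -/
theorem stmt3 (a : ℕ) (ha : 3 ≤ a) :
    ∃ θ ∈ Set.Icc (0 : ℝ) 1,
      HasLevyConstant (mechWord 1 a θ 0) (Real.pi ^ 2 / (12 * Real.log 2)) := by
  choose ℓ hℓ hbound using exists_hasLevyConstant_mechWord (show 1 ≤ a by omega)
  have hcont : Continuous ℓ := continuous_of_abs_log_contQ_sub_le hbound
  have h0 : ℓ 0 ≤ Real.pi ^ 2 / (12 * Real.log 2) :=
    ((hℓ 0).le_log_of_contQ_le (fun i => (mechWord_slope_zero a i).ge)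
      (contQ_le_two_pow (mechWord_slope_zero a))).trans log_two_le_levy
  have h1 : Real.pi ^ 2 / (12 * Real.log 2) ≤ ℓ 1 :=
    levy_le_log.trans ((hℓ 1).log_le_of_le_contQ (by norm_num)
      (pow_le_mul_contQ fun i => ha.trans (mechWord_slope_one a i).ge))
  obtain ⟨θ, hθ, e⟩ := intermediate_value_Icc zero_le_one hcont.continuousOn ⟨h0, h1⟩
  exact ⟨θ, hθ, e ▸ hℓ θ⟩
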